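/- Let t₀ > 0 and n ≥ 0. (a) If t ↦ Sₖ(t) is continuous at t₀ in the operator norm for every k ∈ {0,…,n}, then t ↦ Sₙ(t) is continuous in the operator norm at every t ≥ t₀; likewise, if Sₖ(t₀) is a compact operator for every k ∈ {0,…,n}, then Sₙ(t) is a compact operator for every t ≥ t₀. (b) If Sₖ(t₀) is a compact operator for every k ∈ {0,…,n}, then Sₙ is norm continuous on (t₀, ∞). -/

import Mathlib

open Set Filter MeasureTheory
open scoped Topology

noncomputable section

structure MRSetting (X : Type*) [NormedAddCommGroup X] [NormedSpace ℂ X] [CompleteSpace X]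
    (X₀ : Submodule ℂ X) where
  closed : IsClosed (X₀ : Set X)
  T : ℝ → (X₀ →L[ℂ] X₀)
  S : ℝ → (X →L[ℂ] X₀)
  T_zero : T 0 = 1
  T_add : ∀ t s : ℝ, 0 ≤ t → 0 ≤ s → T (t + s) = (T t).comp (T s)
  T_cont : ∀ x : X₀, ContinuousOn (fun t => T t x) (Ici 0)
  S_zero : S 0 = 0
  S_cont : ∀ x : X, ContinuousOn (fun t => S t x) (Ici 0)
  TS : ∀ t s : ℝ, 0 ≤ t → 0 ≤ s → ∀ x : X, T t (S s x) = S (t + s) x - S t x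
  δ : ℝ → ℝ
  δ_nonneg : ∀ t : ℝ, 0 ≤ t → 0 ≤ δ t
  δ_mono : MonotoneOn δ (Ici 0)
  δ_lim : Tendsto δ (𝓝[>] 0) (𝓝 0)
  SD : (ℝ → X) → ℝ → X₀
  SD_deriv : ∀ f : ℝ → X, ContinuousOn f (Ici 0) → ∀ t ∈ Ici (0:ℝ),
    HasDerivWithinAt (fun τ : ℝ => ∫ s in (0:ℝ)..τ, S (τ - s) (f s)) (SD f t) (Ici 0) t
  SD_cont : ∀ f : ℝ → X, ContinuousOn f (Ici 0) → ContinuousOn (SD f) (Ici 0)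
  SD_bound : ∀ f : ℝ → X, ContinuousOn f (Ici 0) → ∀ t ∈ Ici (0:ℝ),
    ‖SD f t‖ ≤ δ t * ⨆ s : Icc (0:ℝ) t, ‖f (s : ℝ)‖
  SDop : (ℝ → (X₀ →L[ℂ] X)) → ℝ → (X₀ →L[ℂ] X₀)
  SDop_apply : ∀ V : ℝ → (X₀ →L[ℂ] X), (∀ x : X₀, ContinuousOn (fun s => V s x) (Ici 0)) →
    ∀ t : ℝ, ∀ x : X₀, SDop V t x = SD (fun s => V s x) t

variable {X : Type*} [NormedAddCommGroup X] [NormedSpace ℂ X] [CompleteSpace X]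
  {X₀ : Submodule ℂ X}

/-- The perturbation operator `B(U) = S ⋄ (L ∘ U)`. -/
def MRSetting.Bop (M : MRSetting X X₀) (L : X₀ →L[ℂ] X) (U : ℝ → (X₀ →L[ℂ] X₀)) :
    ℝ → (X₀ →L[ℂ] X₀) :=
  M.SDop (fun s => L.comp (U s))


theorem aux_joint {E G : Type*} [NormedAddCommGroup E] [NormedSpace ℂ E] [CompleteSpace E]
    [NormedAddCommGroup G] [NormedSpace ℂ G] (F : ℝ → (E →L[ℂ] G)) (K : Set ℝ) (hK : IsCompact K)
    (hF : ∀ x, ContinuousOn (fun t => F t x) K) :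
    ContinuousOn (fun p : ℝ × E => F p.1 p.2) (K ×ˢ univ) := by
  obtain ⟨C, hC⟩ := banach_steinhaus (g := fun k : K => F k) (by
    intro x
    obtain ⟨C, hC⟩ := hK.exists_bound_of_continuousOn (hF x)
    exact ⟨C, fun k => hC k k.2⟩)
  rintro ⟨t, x⟩ ⟨ht, -⟩
  have h1 : Tendsto (fun p : ℝ × E => F p.1 x) (𝓝[K ×ˢ univ] (t, x)) (𝓝 (F t x)) := by
    have := hF x t ht
    refine Tendsto.comp this ?_
    refine tendsto_nhdsWithin_iff.2 ⟨?_, ?_⟩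
    · exact (continuous_fst.tendsto _).mono_left nhdsWithin_le_nhds
    · filter_upwards [self_mem_nhdsWithin] with p hp using hp.1
  have h2 : Tendsto (fun p : ℝ × E => F p.1 (p.2 - x)) (𝓝[K ×ˢ univ] (t, x)) (𝓝 0) := by
    have h3 : Tendsto (fun p : ℝ × E => C * ‖p.2 - x‖) (𝓝[K ×ˢ univ] (t, x)) (𝓝 0) := by
      have : Continuous (fun p : ℝ × E => C * ‖p.2 - x‖) := by fun_prop
      have h := (this.tendsto (t, x)).mono_left (nhdsWithin_le_nhds (s := K ×ˢ univ))
      simpa using h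
    refine squeeze_zero_norm' ?_ h3
    filter_upwards [self_mem_nhdsWithin] with p hp
    exact (F p.1).le_of_opNorm_le (hC ⟨p.1, hp.1⟩) _
  have h := h1.add h2
  simp only [← map_add, add_sub_cancel, add_zero] at h
  exact h

theorem aux_comp {E G : Type*} [NormedAddCommGroup E] [NormedSpace ℂ E] [CompleteSpace E]
    [NormedAddCommGroup G] [NormedSpace ℂ G] (F : ℝ → (E →L[ℂ] G))
    (hF : ∀ x, ContinuousOn (fun t => F t x) (Ici 0)) (f : ℝ → E) (hf : ContinuousOn f (Ici 0))
    (t a b : ℝ) (h0 : 0 ≤ a) (hb : b ≤ t) :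
    ContinuousOn (fun r => F (t - r) (f r)) (Icc a b) := by
  have h := aux_joint F (Icc 0 t) isCompact_Icc (fun x => (hF x).mono (fun y hy => hy.1))
  refine h.comp (f := fun r : ℝ => (t - r, f r)) ?_ ?_
  · exact ContinuousOn.prodMk (by fun_prop) (hf.mono fun y hy => h0.trans hy.1)
  · intro r hr
    have := hr.1
    have := hr.2
    exact ⟨⟨by linarith, by linarith⟩, trivial⟩

theorem aux_compact {E G H : Type*} [NormedAddCommGroup E] [NormedSpace ℂ E] [CompleteSpace E]
    [NormedAddCommGroup G] [NormedSpace ℂ G] [NormedAddCommGroup H] [NormedSpace ℂ H]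
    (F : ℝ → (E →L[ℂ] G))
    (hF : ∀ x, ContinuousOn (fun t => F t x) (Ici 0)) (K : H →L[ℂ] E) (hK : IsCompactOperator ⇑K)
    (s : ℝ) (hs : 0 < s) : ContinuousAt (fun t => (F t).comp K) s := by
  have h := aux_joint F (Icc 0 (s+1)) isCompact_Icc (fun x => (hF x).mono (fun y hy => hy.1))
  have hc : IsCompact (closure (K '' Metric.closedBall 0 1)) :=
    hK.isCompact_closure_image_closedBall 1
  rw [Metric.continuousAt_iff']
  intro ε hε
  obtain ⟨v, hv, hv'⟩ := hc.mem_uniformity_of_prod (f := fun t x => F t x) (s := Icc 0 (s+1))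
    (q := s) (h.mono (prod_mono_right (subset_univ _))) ⟨hs.le, by linarith⟩
    (Metric.dist_mem_uniformity (half_pos hε))
  rw [nhdsWithin_eq_nhds.2 (Icc_mem_nhds hs (by linarith))] at hv
  filter_upwards [hv] with t ht
  rw [dist_eq_norm]
  refine lt_of_le_of_lt ?_ (half_lt_self hε)
  refine ContinuousLinearMap.opNorm_le_of_unit_norm (𝕜 := ℂ) (half_pos hε).le ?_
  intro x hx
  have := hv' t ht (K x) (subset_closure ⟨x, by simp [hx], rfl⟩)
  rw [mem_ofPred_eq, dist_eq_norm] at this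
  exact this.le

theorem aux_unique {G : Type*} [NormedAddCommGroup G] [NormedSpace ℝ G] {φ ψ : ℝ → G} {a b : G}
    {t : ℝ} (ht : 0 ≤ t) (h1 : HasDerivWithinAt φ a (Ici 0) t)
    (h2 : HasDerivWithinAt ψ b (Ici 0) t) (h : ∀ τ, 0 ≤ τ → φ τ = ψ τ) : a = b := by
  have h3 : HasDerivWithinAt φ b (Ici 0) t := h2.congr (fun τ hτ => h τ hτ) (h t ht)
  exact (uniqueDiffOn_Ici 0 t ht).eq_deriv _ h1 h3

theorem aux_ii (M : MRSetting X X₀) (f : ℝ → X) (hf : ContinuousOn f (Ici 0)) (t a b : ℝ)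
    (h0 : 0 ≤ a) (hab : a ≤ b) (hb : b ≤ t) :
    IntervalIntegrable (fun r => M.S (t - r) (f r)) volume a b := by
  apply ContinuousOn.intervalIntegrable
  rw [uIcc_of_le hab]
  exact aux_comp M.S M.S_cont f hf t a b h0 hb

theorem SD_congr (M : MRSetting X X₀) (f g : ℝ → X) (hf : ContinuousOn f (Ici 0))
    (hg : ContinuousOn g (Ici 0)) (h : ∀ t, 0 ≤ t → f t = g t) (t : ℝ) (ht : 0 ≤ t) :
    M.SD f t = M.SD g t := by
  refine aux_unique ht (M.SD_deriv f hf t ht) (M.SD_deriv g hg t ht) ?_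
  intro τ hτ
  apply intervalIntegral.integral_congr
  intro r hr
  rw [uIcc_of_le hτ] at hr
  simp only [h r hr.1]

theorem SD_zero (M : MRSetting X X₀) (t : ℝ) (ht : 0 ≤ t) : M.SD (fun _ => 0) t = 0 := by
  refine aux_unique ht (M.SD_deriv _ continuousOn_const t ht)
    (hasDerivWithinAt_const t (Ici 0) (0 : X₀)) ?_
  intro τ hτ
  simp

theorem SD_add (M : MRSetting X X₀) (f g : ℝ → X) (hf : ContinuousOn f (Ici 0))
    (hg : ContinuousOn g (Ici 0)) (t : ℝ) (ht : 0 ≤ t) :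
    M.SD (fun s => f s + g s) t = M.SD f t + M.SD g t := by
  refine aux_unique ht (M.SD_deriv _ (hf.add hg) t ht)
    ((M.SD_deriv f hf t ht).add (M.SD_deriv g hg t ht)) ?_
  intro τ hτ
  simp only [map_add, Pi.add_apply]
  exact intervalIntegral.integral_add (aux_ii M f hf τ 0 τ le_rfl hτ le_rfl)
    (aux_ii M g hg τ 0 τ le_rfl hτ le_rfl)

theorem SD_sum (M : MRSetting X X₀) (f : ℕ → ℝ → X) (hf : ∀ k, ContinuousOn (f k) (Ici 0))
    (n : ℕ) (t : ℝ) (ht : 0 ≤ t) :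
    M.SD (fun s => ∑ k ∈ Finset.range n, f k s) t = ∑ k ∈ Finset.range n, M.SD (f k) t := by
  induction n with
  | zero => simpa using SD_zero M t ht
  | succ n ih =>
    simp only [Finset.sum_range_succ]
    rw [SD_add M _ _ (continuousOn_finsetSum _ fun k _ => hf k) (hf n) t ht, ih]

theorem SD_at_zero (M : MRSetting X X₀) (f : ℝ → X) (hf : ContinuousOn f (Ici 0)) :
    M.SD f 0 = 0 := by
  have h0 : M.δ 0 ≤ 0 := by
    refine ge_of_tendsto M.δ_lim ?_
    filter_upwards [self_mem_nhdsWithin] with t ht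
    exact M.δ_mono (mem_Ici.2 le_rfl) (mem_Ici.2 (le_of_lt ht)) (le_of_lt ht)
  have h1 : M.δ 0 = 0 := le_antisymm h0 (M.δ_nonneg 0 le_rfl)
  have := M.SD_bound f hf 0 (mem_Ici.2 le_rfl)
  rw [h1, zero_mul] at this
  exact norm_le_zero_iff.1 this

theorem shift_cont {f : ℝ → X} (hf : ContinuousOn f (Ici 0)) (t : ℝ) (ht : 0 ≤ t) :
    ContinuousOn (fun r => f (t + r)) (Ici 0) :=
  hf.comp (by fun_prop) (fun r hr => add_nonneg ht hr)

theorem conv_shift (M : MRSetting X X₀) (f : ℝ → X) (hf : ContinuousOn f (Ici 0))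
    (t s : ℝ) (ht : 0 ≤ t) (hs : 0 ≤ s) :
    ∫ r in (0:ℝ)..(t+s), M.S (t + s - r) (f r) =
      M.T s (∫ r in (0:ℝ)..t, M.S (t - r) (f r)) + M.S s (∫ r in (0:ℝ)..t, f r)
      + ∫ r in (0:ℝ)..s, M.S (s - r) (f (t + r)) := by
  haveI : CompleteSpace X₀ := M.closed.completeSpace_coe
  have hfi : IntervalIntegrable f volume 0 t := by
    apply ContinuousOn.intervalIntegrable
    rw [uIcc_of_le ht]
    exact hf.mono fun y hy => hy.1
  have hi := aux_ii M f hf t 0 t le_rfl ht le_rfl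
  rw [← intervalIntegral.integral_add_adjacent_intervals
    (aux_ii M f hf (t+s) 0 t le_rfl ht (by linarith))
    (aux_ii M f hf (t+s) t (t+s) ht (by linarith) le_rfl)]
  congr 1
  · rw [← ContinuousLinearMap.intervalIntegral_comp_comm _ hi,
      ← ContinuousLinearMap.intervalIntegral_comp_comm _ hfi,
      ← intervalIntegral.integral_add]
    · apply intervalIntegral.integral_congr
      intro r hr
      rw [uIcc_of_le ht] at hr
      have := M.TS s (t - r) hs (by linarith [hr.2]) (f r)
      simp only [this]
      rw [show s + (t - r) = t + s - r by ring]
      abel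
    · exact ⟨(M.T s).integrable_comp hi.1, (M.T s).integrable_comp hi.2⟩
    · exact ⟨(M.S s).integrable_comp hfi.1, (M.S s).integrable_comp hfi.2⟩
  · have := intervalIntegral.integral_comp_add_left (a := 0) (b := s)
      (fun r => M.S (t + s - r) (f r)) t
    rw [add_zero] at this
    rw [← this]
    apply intervalIntegral.integral_congr
    intro r hr
    simp only [show t + s - (t + r) = s - r by ring]

theorem SD_shift (M : MRSetting X X₀) (f : ℝ → X) (hf : ContinuousOn f (Ici 0))
    (t s : ℝ) (ht : 0 ≤ t) (hs : 0 ≤ s) :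
    M.SD f (t + s) = M.T s (M.SD f t) + M.SD (fun r => f (t + r)) s := by
  have hg := shift_cont hf t ht
  set y := ∫ r in (0:ℝ)..t, M.S (t - r) (f r) with hy
  set z := ∫ r in (0:ℝ)..t, f r with hz
  have hshift : ∀ (a c : ℝ) (φ : ℝ → X₀) (d : X₀), 0 ≤ a → 0 ≤ c →
      HasDerivWithinAt φ d (Ici 0) (a + c) →
      HasDerivWithinAt (fun τ => φ (a + τ)) d (Ici 0) c := by
    intro a c φ d ha hc h
    have h1 : HasDerivWithinAt (fun τ : ℝ => a + τ) 1 (Ici 0) c :=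
      ((hasDerivAt_id c).const_add a).hasDerivWithinAt
    have := HasDerivWithinAt.scomp (h := fun τ : ℝ => a + τ) c h h1
      (fun r hr => add_nonneg ha hr)
    rw [one_smul] at this
    exact this
  have hder : ∀ c, 0 ≤ c → HasDerivWithinAt (fun τ => M.T τ y + M.S τ z)
      (M.SD f (t + c) - M.SD (fun r => f (t + r)) c) (Ici 0) c := by
    intro c hc
    have h1 := hshift t c _ _ ht hc (M.SD_deriv f hf (t + c) (add_nonneg ht hc))
    have h2 := h1.sub (M.SD_deriv _ hg c hc)
    have key : ∀ τ ∈ Ici (0:ℝ), M.T τ y + M.S τ z =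
        (∫ r in (0:ℝ)..(t+τ), M.S (t + τ - r) (f r))
          - ∫ r in (0:ℝ)..τ, M.S (τ - r) (f (t + r)) := by
      intro τ hτ
      rw [conv_shift M f hf t τ ht hτ]
      abel
    exact h2.congr key (key c hc)
  have hd0 := hder 0 le_rfl
  rw [SD_at_zero M _ hg, add_zero, sub_zero] at hd0
  have h1 := hshift s 0 _ _ hs le_rfl (by rw [add_zero]; exact hder s hs)
  have h2 : HasDerivWithinAt (fun τ => M.T s (M.T τ y + M.S τ z) + M.S s z)
      (M.T s (M.SD f t)) (Ici 0) 0 :=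
    (((M.T s).restrictScalars ℝ).hasFDerivAt.comp_hasDerivWithinAt 0 hd0).add_const _
  have := aux_unique le_rfl h1 h2 (by
    intro τ hτ
    simp only [map_add, M.TS s τ hs hτ z, M.T_add s τ hs hτ, ContinuousLinearMap.comp_apply]
    abel)
  rw [← this]
  abel

theorem Bop_apply (M : MRSetting X X₀) (L : X₀ →L[ℂ] X) (U : ℝ → (X₀ →L[ℂ] X₀))
    (hU : ∀ x, ContinuousOn (fun t => U t x) (Ici 0)) (t : ℝ) (x : X₀) :
    M.Bop L U t x = M.SD (fun s => L (U s x)) t := by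
  unfold MRSetting.Bop
  exact M.SDop_apply (fun s => L.comp (U s))
    (fun x => L.continuous.comp_continuousOn (hU x)) t x

theorem Sn_cont (M : MRSetting X X₀) (L : X₀ →L[ℂ] X) (n : ℕ) :
    ∀ x, ContinuousOn (fun t => (M.Bop L)^[n] M.T t x) (Ici 0) := by
  induction n with
  | zero => exact M.T_cont
  | succ n ih =>
    intro x
    simp only [Function.iterate_succ_apply']
    simp only [Bop_apply M L _ ih]
    exact M.SD_cont _ (L.continuous.comp_continuousOn (ih x))

theorem Sn_add (M : MRSetting X X₀) (L : X₀ →L[ℂ] X) (n : ℕ) :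
    ∀ t s : ℝ, 0 ≤ t → 0 ≤ s → (M.Bop L)^[n] M.T (t + s) =
      ∑ k ∈ Finset.range (n+1), ((M.Bop L)^[k] M.T s).comp ((M.Bop L)^[n - k] M.T t) := by
  induction n with
  | zero =>
    intro t s ht hs
    simp [add_comm t s, M.T_add s t hs ht]
  | succ n ih =>
    intro t s ht hs
    ext1 x
    have hc : ContinuousOn (fun r => L ((M.Bop L)^[n] M.T r x)) (Ici 0) :=
      L.continuous.comp_continuousOn (Sn_cont M L n x)
    rw [Function.iterate_succ_apply', Bop_apply M L _ (Sn_cont M L n), SD_shift M _ hc t s ht hs,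
      Finset.sum_range_succ', ContinuousLinearMap.add_apply, add_comm]
    congr 1
    · have hk : ∀ k, ContinuousOn (fun r => L ((M.Bop L)^[k] M.T r ((M.Bop L)^[n - k] M.T t x)))
          (Ici 0) := fun k => L.continuous.comp_continuousOn (Sn_cont M L k _)
      rw [SD_congr M _ (fun r => ∑ k ∈ Finset.range (n+1),
        L ((M.Bop L)^[k] M.T r ((M.Bop L)^[n - k] M.T t x))) (shift_cont hc t ht)
        (continuousOn_finsetSum _ fun k _ => hk k) ?_ s hs]
      · rw [SD_sum M _ hk _ s hs, ContinuousLinearMap.sum_apply]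
        refine Finset.sum_congr rfl fun k _ => ?_
        rw [ContinuousLinearMap.comp_apply, Function.iterate_succ_apply',
          Bop_apply M L _ (Sn_cont M L k), Nat.add_sub_add_right]
      · intro r hr
        rw [ih t r ht hr, ContinuousLinearMap.sum_apply, map_sum]
        rfl
    · rw [ContinuousLinearMap.comp_apply, Nat.sub_zero, Function.iterate_succ_apply',
        Bop_apply M L _ (Sn_cont M L n)]
      rfl

/-- propagation of norm continuity and compactness of the terms `Sₙ`. -/
theorem Sn_propagation (M : MRSetting X X₀) (L : X₀ →L[ℂ] X)
    (n : ℕ) (t₀ : ℝ) (ht₀ : 0 < t₀) :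
    ((∀ k ≤ n, ContinuousAt ((M.Bop L)^[k] M.T) t₀) →
      ∀ t : ℝ, t₀ ≤ t → ContinuousAt ((M.Bop L)^[n] M.T) t) ∧
    ((∀ k ≤ n, IsCompactOperator ⇑((M.Bop L)^[k] M.T t₀)) →
      ∀ t : ℝ, t₀ ≤ t → IsCompactOperator ⇑((M.Bop L)^[n] M.T t)) ∧
    ((∀ k ≤ n, IsCompactOperator ⇑((M.Bop L)^[k] M.T t₀)) →
      ContinuousOn ((M.Bop L)^[n] M.T) (Ioi t₀)) := by
  refine ⟨?_, ?_, ?_⟩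
  · intro h t ht
    have h1 : ContinuousAt (fun t' => ∑ k ∈ Finset.range (n+1),
        ((M.Bop L)^[k] M.T (t - t₀)).comp ((M.Bop L)^[n - k] M.T (t' - (t - t₀)))) t := by
      refine tendsto_finsetSum _ fun k hk => ?_
      have h2 : ContinuousAt (fun t' => (M.Bop L)^[n - k] M.T (t' - (t - t₀))) t := by
        have h3 := h (n - k) (Nat.sub_le _ _)
        refine ContinuousAt.comp (f := fun t' : ℝ => t' - (t - t₀)) ?_ (by fun_prop)
        rw [show t - (t - t₀) = t₀ by ring]
        exact h3
      exact (continuousAt_const (y := (M.Bop L)^[k] M.T (t - t₀))).clm_comp h2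
    refine h1.congr ?_
    filter_upwards [Ioi_mem_nhds (show t - t₀ < t by linarith)] with t' ht'
    have ht'' : t - t₀ < t' := ht'
    rw [← Sn_add M L n _ _ (by linarith) (by linarith)]
    ring_nf
  · intro h t ht
    have h1 := Sn_add M L n t₀ (t - t₀) ht₀.le (by linarith)
    rw [add_sub_cancel] at h1
    rw [h1]
    refine Submodule.sum_mem (compactOperator (RingHom.id ℂ) X₀ X₀) fun k hk => ?_
    exact (h (n - k) (Nat.sub_le _ _)).clm_comp _
  · intro h
    haveI : CompleteSpace X₀ := M.closed.completeSpace_coe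
    intro t ht
    have ht' : t₀ < t := ht
    apply ContinuousAt.continuousWithinAt
    have h1 : ContinuousAt (fun t' => ∑ k ∈ Finset.range (n+1),
        ((M.Bop L)^[k] M.T (t' - t₀)).comp ((M.Bop L)^[n - k] M.T t₀)) t := by
      refine tendsto_finsetSum _ fun k hk => ?_
      have h2 := aux_compact _ (Sn_cont M L k) _ (h (n - k) (Nat.sub_le _ _)) (t - t₀)
        (by linarith)
      exact ContinuousAt.comp (f := fun t' : ℝ => t' - t₀) h2 (by fun_prop)
    refine h1.congr ?_
    filter_upwards [Ioi_mem_nhds ht'] with t' ht''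
    have h3 : t₀ < t' := ht''
    rw [← Sn_add M L n _ _ ht₀.le (by linarith)]
    ring_nf

end
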